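/- arXiv:2411.07260 — 2 statements merged into one kernel-verified Lean document; each statement's English description precedes it below -/
import Mathlib

section
/- For any smooth compactly supported function φ on ℝⁿ with n > 2, the integral of |∇φ|² over ℝⁿ is at least ((n-2)/2)² times the integral of φ(x)²/|x|² over ℝⁿ. -/
open MeasureTheory

lemma hardy_coord (n : ℕ) (c ε : ℝ) (hε : 0 < ε)
    (φ : EuclideanSpace ℝ (Fin n) → ℝ) (hφ : ContDiff ℝ (⊤ : ℕ∞) φ)
    (hsupp : HasCompactSupport φ) (i : Fin n) :
    ∫ x, (φ x ^ 2 * (c * (‖x‖ ^ 2 + ε)⁻¹ - (2 * c + c ^ 2) * (x i ^ 2 * ((‖x‖ ^ 2 + ε)⁻¹) ^ 2)))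
      ≤ ∫ x, (fderiv ℝ φ x (EuclideanSpace.single i 1)) ^ 2 := by
  have hpos : ∀ x : EuclideanSpace ℝ (Fin n), ‖x‖ ^ 2 + ε ≠ 0 := fun x => by positivity
  have hφc : Continuous φ := hφ.continuous
  have hφd : Differentiable ℝ φ := hφ.differentiable (by simp)
  have hDc : Continuous (fun x => fderiv ℝ φ x (EuclideanSpace.single i 1)) :=
    (hφ.continuous_fderiv (by simp)).clm_apply continuous_const
  have hDs : HasCompactSupport (fun x => fderiv ℝ φ x (EuclideanSpace.single i 1)) :=
    hsupp.fderiv_apply ℝ _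
  have hwc : Continuous (fun x : EuclideanSpace ℝ (Fin n) => (‖x‖ ^ 2 + ε)⁻¹) :=
    Continuous.inv₀ (by fun_prop) hpos
  have hxc : Continuous (fun x : EuclideanSpace ℝ (Fin n) => x i) := by fun_prop
  -- derivative of the vector field
  have hg : ∀ x : EuclideanSpace ℝ (Fin n), HasFDerivAt
      (fun x : EuclideanSpace ℝ (Fin n) => x i * (‖x‖ ^ 2 + ε)⁻¹)
      (x i • (-((‖x‖ ^ 2 + ε) ^ 2)⁻¹ • ((2 : ℕ) • innerSL ℝ x)) +
        (‖x‖ ^ 2 + ε)⁻¹ • (EuclideanSpace.proj i : EuclideanSpace ℝ (Fin n) →L[ℝ] ℝ)) x := by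
    intro x
    have h1 : HasFDerivAt (fun x : EuclideanSpace ℝ (Fin n) => x i)
      (EuclideanSpace.proj i : EuclideanSpace ℝ (Fin n) →L[ℝ] ℝ) x :=
      (EuclideanSpace.proj i : EuclideanSpace ℝ (Fin n) →L[ℝ] ℝ).hasFDerivAt
    have h2 : HasFDerivAt (fun x : EuclideanSpace ℝ (Fin n) => ‖x‖ ^ 2 + ε)
      ((2 : ℕ) • innerSL ℝ x) x :=
      (hasStrictFDerivAt_norm_sq x).hasFDerivAt.add_const ε
    have h3 := (hasDerivAt_inv (hpos x)).comp_hasFDerivAt x h2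
    exact h1.mul h3
  have hg' : ∀ x : EuclideanSpace ℝ (Fin n), fderiv ℝ
      (fun x : EuclideanSpace ℝ (Fin n) => x i * (‖x‖ ^ 2 + ε)⁻¹) x (EuclideanSpace.single i 1)
      = (‖x‖ ^ 2 + ε)⁻¹ - 2 * (x i ^ 2 * ((‖x‖ ^ 2 + ε)⁻¹) ^ 2) := by
    intro x
    rw [(hg x).fderiv]
    simp [EuclideanSpace.inner_single_right]
    ring
  have hf' : ∀ x : EuclideanSpace ℝ (Fin n), fderiv ℝ
      (fun x : EuclideanSpace ℝ (Fin n) => φ x ^ 2) x (EuclideanSpace.single i 1)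
      = 2 * φ x * fderiv ℝ φ x (EuclideanSpace.single i 1) := by
    intro x
    rw [((hφd x).hasFDerivAt.pow 2).fderiv]
    simp
  have int_of : ∀ F : EuclideanSpace ℝ (Fin n) → ℝ, Continuous F →
      (∀ x, φ x = 0 → F x = 0) → Integrable F := by
    intro F hF h0
    apply hF.integrable_of_hasCompactSupport
    exact hsupp.mono (fun x hx => by
      simp only [Function.mem_support] at hx ⊢
      exact fun h => hx (h0 x h))
  have I1 : Integrable (fun x => φ x ^ 2 * ((‖x‖ ^ 2 + ε)⁻¹ - 2 * (x i ^ 2 * ((‖x‖ ^ 2 + ε)⁻¹) ^ 2))) :=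
    int_of _ (by fun_prop) (by intro x h; simp [h])
  have I2 : Integrable (fun x => 2 * φ x * fderiv ℝ φ x (EuclideanSpace.single i 1) *
      (x i * (‖x‖ ^ 2 + ε)⁻¹)) :=
    int_of _ (by fun_prop) (by intro x h; simp [h])
  have I3 : Integrable (fun x => φ x ^ 2 * (x i * (‖x‖ ^ 2 + ε)⁻¹)) :=
    int_of _ (by fun_prop) (by intro x h; simp [h])
  have I4 : Integrable (fun x => φ x ^ 2 * (c ^ 2 * (x i ^ 2 * ((‖x‖ ^ 2 + ε)⁻¹) ^ 2))) :=
    int_of _ (by fun_prop) (by intro x h; simp [h])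
  have I5 : Integrable (fun x => (fderiv ℝ φ x (EuclideanSpace.single i 1)) ^ 2) := by
    apply (hDc.pow 2).integrable_of_hasCompactSupport
    exact hDs.mono (fun x hx => by
      simp only [Function.mem_support] at hx ⊢
      exact fun h => hx (by simp [h]))
  have key := integral_mul_fderiv_eq_neg_fderiv_mul_of_integrable
    (μ := (volume : Measure (EuclideanSpace ℝ (Fin n)))) (f := fun x => φ x ^ 2)
    (g := fun x : EuclideanSpace ℝ (Fin n) => x i * (‖x‖ ^ 2 + ε)⁻¹)
    (v := EuclideanSpace.single i 1)
    (by simpa only [hf'] using I2) (by simpa only [hg'] using I1) I3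
    (fun x _ => (hφd x).pow 2) (fun x _ => (hg x).differentiableAt)
  simp only [hf', hg'] at key
  have e : ∫ x, (φ x ^ 2 * (c * (‖x‖ ^ 2 + ε)⁻¹ - (2 * c + c ^ 2) *
        (x i ^ 2 * ((‖x‖ ^ 2 + ε)⁻¹) ^ 2)))
      = c * (∫ x, φ x ^ 2 * ((‖x‖ ^ 2 + ε)⁻¹ - 2 * (x i ^ 2 * ((‖x‖ ^ 2 + ε)⁻¹) ^ 2)))
        - ∫ x, φ x ^ 2 * (c ^ 2 * (x i ^ 2 * ((‖x‖ ^ 2 + ε)⁻¹) ^ 2)) := by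
    rw [← integral_const_mul, ← integral_sub (I1.const_mul c) I4]
    congr 1; ext x; ring
  have I6 := I2.const_mul (-c)
  rw [e, key, mul_neg, ← neg_mul, ← integral_const_mul, ← integral_sub I6 I4]
  apply integral_mono (I6.sub I4) I5
  intro x
  simp only [Pi.sub_apply]
  nlinarith [sq_nonneg (fderiv ℝ φ x (EuclideanSpace.single i 1) + c * φ x * (x i * (‖x‖ ^ 2 + ε)⁻¹))]

lemma hardy_eps (n : ℕ) (hn : 2 < n) (ε : ℝ) (hε : 0 < ε)
    (φ : EuclideanSpace ℝ (Fin n) → ℝ) (hφ : ContDiff ℝ (⊤ : ℕ∞) φ)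
    (hsupp : HasCompactSupport φ) :
    ((n - 2 : ℝ) / 2) ^ 2 * ∫ x, (φ x) ^ 2 / (‖x‖ ^ 2 + ε) ≤ ∫ x, ‖gradient φ x‖ ^ 2 := by
  have hpos : ∀ x : EuclideanSpace ℝ (Fin n), ‖x‖ ^ 2 + ε ≠ 0 := fun x => by positivity
  have hφc : Continuous φ := hφ.continuous
  have hwc : Continuous (fun x : EuclideanSpace ℝ (Fin n) => (‖x‖ ^ 2 + ε)⁻¹) :=
    Continuous.inv₀ (by fun_prop) hpos
  have int_of : ∀ F : EuclideanSpace ℝ (Fin n) → ℝ, Continuous F →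
      (∀ x, φ x = 0 → F x = 0) → Integrable F := by
    intro F hF h0
    apply hF.integrable_of_hasCompactSupport
    exact hsupp.mono (fun x hx => by
      simp only [Function.mem_support] at hx ⊢
      exact fun h => hx (h0 x h))
  have hgrad : ∀ x, ‖gradient φ x‖ ^ 2 =
      ∑ i, (fderiv ℝ φ x (EuclideanSpace.single i 1)) ^ 2 := by
    intro x
    rw [EuclideanSpace.real_norm_sq_eq]
    refine Finset.sum_congr rfl fun i _ => ?_
    have : fderiv ℝ φ x (EuclideanSpace.single i 1) = gradient φ x i := by
      have h := InnerProductSpace.toDual_symm_apply (𝕜 := ℝ)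
        (x := EuclideanSpace.single i (1 : ℝ)) (y := fderiv ℝ φ x)
      rw [← h, EuclideanSpace.inner_single_right]
      simp [gradient]
    rw [this]
  simp only [hgrad]
  set c : ℝ := (n - 2 : ℝ) / 2 with hc
  have hc0 : 0 < c := by
    have : (2 : ℝ) < n := by exact_mod_cast hn
    rw [hc]; linarith
  rw [integral_finsetSum]
  swap
  · intro i _
    have hDc : Continuous (fun x => fderiv ℝ φ x (EuclideanSpace.single i 1)) :=
      (hφ.continuous_fderiv (by simp)).clm_apply continuous_const
    have hDs : HasCompactSupport (fun x => fderiv ℝ φ x (EuclideanSpace.single i 1)) :=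
      hsupp.fderiv_apply ℝ _
    apply (hDc.pow 2).integrable_of_hasCompactSupport
    exact hDs.mono (fun x hx => by
      simp only [Function.mem_support] at hx ⊢
      exact fun h => hx (by simp [h]))
  refine le_trans ?_ (Finset.sum_le_sum fun i _ => hardy_coord n c ε hε φ hφ hsupp i)
  have hI : ∀ i : Fin n, Integrable (fun x : EuclideanSpace ℝ (Fin n) =>
      φ x ^ 2 * (c * (‖x‖ ^ 2 + ε)⁻¹ - (2 * c + c ^ 2) *
        (x i ^ 2 * ((‖x‖ ^ 2 + ε)⁻¹) ^ 2))) := fun i =>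
    int_of _ (by fun_prop) (by intro x h; simp [h])
  rw [← integral_finsetSum _ (fun i _ => hI i), ← integral_const_mul]
  apply integral_mono
  · apply int_of
    · simp only [div_eq_mul_inv]; fun_prop
    · intro x h; simp [h]
  · exact integrable_finsetSum _ (fun i _ => hI i)
  · intro x
    simp only
    rw [← Finset.mul_sum, Finset.sum_sub_distrib, ← Finset.mul_sum, ← Finset.mul_sum,
      ← Finset.sum_mul,
      ← EuclideanSpace.real_norm_sq_eq]
    simp only [Finset.sum_const, Finset.card_univ, Fintype.card_fin, nsmul_eq_mul]
    have hnc : (n : ℝ) = 2 * c + 2 := by rw [hc]; ring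
    rw [hnc, div_eq_mul_inv]
    have hw0 : 0 < (‖x‖ ^ 2 + ε)⁻¹ := by positivity
    have hw1 : ‖x‖ ^ 2 * (‖x‖ ^ 2 + ε)⁻¹ ≤ 1 := by
      rw [← div_eq_mul_inv, div_le_one (by positivity)]; linarith
    set w := (‖x‖ ^ 2 + ε)⁻¹
    have h : 0 ≤ φ x ^ 2 * ((2 * c + c ^ 2) * (w * (1 - ‖x‖ ^ 2 * w))) := by
      have := sub_nonneg.2 hw1
      positivity
    nlinarith [h]

/-- Classical Hardy inequality on ℝⁿ, n > 2. -/
theorem hardy_inequality_euclidean (n : ℕ) (hn : 2 < n)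
    (φ : EuclideanSpace ℝ (Fin n) → ℝ) (hφ : ContDiff ℝ (⊤ : ℕ∞) φ)
    (hsupp : HasCompactSupport φ) :
    ((n - 2 : ℝ) / 2) ^ 2 * ∫ x, (φ x) ^ 2 / ‖x‖ ^ 2 ≤ ∫ x, ‖gradient φ x‖ ^ 2 := by
  by_cases hint : Integrable (fun x => (φ x) ^ 2 / ‖x‖ ^ 2)
  swap
  · rw [integral_undef hint, mul_zero]
    exact integral_nonneg fun x => by positivity
  have : NeZero n := ⟨by omega⟩
  have hne : ∀ᵐ x : EuclideanSpace ℝ (Fin n), x ≠ 0 := by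
    have : Nontrivial (EuclideanSpace ℝ (Fin n)) := inferInstance
    exact Measure.ae_ne volume 0
  have hlim : Filter.Tendsto
      (fun k : ℕ => ∫ x, (φ x) ^ 2 / (‖x‖ ^ 2 + 1 / ((k : ℝ) + 1))) Filter.atTop
      (nhds (∫ x, (φ x) ^ 2 / ‖x‖ ^ 2)) := by
    apply tendsto_integral_of_dominated_convergence (fun x => (φ x) ^ 2 / ‖x‖ ^ 2)
    · intro k
      apply Continuous.aestronglyMeasurable
      apply Continuous.div (by have := hφ.continuous; fun_prop) (by fun_prop)
      intro x
      positivity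
    · exact hint
    · intro k
      filter_upwards [hne] with x hx
      have : 0 < ‖x‖ := norm_pos_iff.2 hx
      rw [Real.norm_of_nonneg (by positivity)]
      apply div_le_div_of_nonneg_left (by positivity) (by positivity)
      have : (0 : ℝ) ≤ 1 / ((k : ℝ) + 1) := by positivity
      linarith
    · filter_upwards [hne] with x hx
      have : 0 < ‖x‖ := norm_pos_iff.2 hx
      apply Filter.Tendsto.div tendsto_const_nhds _ (by positivity)
      simpa using (tendsto_const_nhds (x := ‖x‖ ^ 2)).add
        (tendsto_one_div_add_atTop_nhds_zero_nat (𝕜 := ℝ))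
  exact le_of_tendsto' (hlim.const_mul _) fun k =>
    hardy_eps n hn _ (by positivity) φ hφ hsupp
end

section
/- For any smooth compactly supported function φ on ℝⁿ with n ≥ 5, the integral of |Δφ|² over ℝⁿ is at least n²(n-4)²/16 times the integral of φ(x)²/|x|⁴ over ℝⁿ. -/
open MeasureTheory

/-- The Euclidean Laplacian of a function on ℝⁿ, as the sum of the pure second
partial derivatives in the coordinate directions. -/
noncomputable def euclideanLaplacian {n : ℕ} (φ : EuclideanSpace ℝ (Fin n) → ℝ)
    (x : EuclideanSpace ℝ (Fin n)) : ℝ :=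
  ∑ i : Fin n,
    fderiv ℝ (fun y => fderiv ℝ φ y (EuclideanSpace.single i 1)) x (EuclideanSpace.single i 1)

lemma integral_fderiv_eq_zero_aux {n : ℕ} (F : EuclideanSpace ℝ (Fin n) → ℝ)
    (hF : ContDiff ℝ 1 F) (hs : HasCompactSupport F) (v : EuclideanSpace ℝ (Fin n)) :
    Integrable (fun x => fderiv ℝ F x v) ∧ ∫ x, fderiv ℝ F x v = 0 := by
  have hc : Continuous (fun x => fderiv ℝ F x v) :=
    (hF.continuous_fderiv (by norm_num)).clm_apply continuous_const
  have hi : Integrable (fun x => fderiv ℝ F x v) :=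
    hc.integrable_of_hasCompactSupport (hs.fderiv_apply (𝕜 := ℝ) v)
  refine ⟨hi, ?_⟩
  have h := integral_mul_fderiv_eq_neg_fderiv_mul_of_integrable
    (μ := (volume : Measure (EuclideanSpace ℝ (Fin n)))) (f := fun _ => (1 : ℝ)) (g := F) (v := v)
    (by simp) (by simpa using hi)
    (by simpa using hF.continuous.integrable_of_hasCompactSupport hs)
    (by intros; fun_prop) (fun x _ => (hF.differentiable (by norm_num)) x)
  simpa using h

lemma pointwise_aux (a C N L p u X G R ε : ℝ) (ha : 0 ≤ a) (hN : N = 2 * a + 4)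
    (hC : C = a ^ 2 + 2 * a) (hu : 0 ≤ u) (hε : 0 ≤ ε) (hR : R * u = 1 - ε * u)
    (hQ : 0 ≤ G + 2 * a * p * u * X + a ^ 2 * p ^ 2 * u ^ 2 * R) :
    C ^ 2 * (p ^ 2 * u ^ 2) ≤ L ^ 2 + 2 * C * (G * u + p * L * u - 2 * p * X * u ^ 2
      + (a + 1) * (2 * p * X * u ^ 2 + N * p ^ 2 * u ^ 2 - 4 * p ^ 2 * R * u ^ 3)) := by
  have hC0 : 0 ≤ C := by rw [hC]; positivity
  have h1 : 0 ≤ 2 * C * (u * (G + 2 * a * p * u * X + a ^ 2 * p ^ 2 * u ^ 2 * R)) := by positivity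
  have h2 : 0 ≤ 2 * C * (p ^ 2 * u ^ 2 * (ε * u * (a + 2) ^ 2)) := by positivity
  have key : L ^ 2 + 2 * C * (G * u + p * L * u - 2 * p * X * u ^ 2
      + (a + 1) * (2 * p * X * u ^ 2 + N * p ^ 2 * u ^ 2 - 4 * p ^ 2 * R * u ^ 3))
      - C ^ 2 * (p ^ 2 * u ^ 2) = (L + C * p * u) ^ 2
      + 2 * C * (u * (G + 2 * a * p * u * X + a ^ 2 * p ^ 2 * u ^ 2 * R))
      + 2 * C * (p ^ 2 * u ^ 2 * (ε * u * (a + 2) ^ 2)) := by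
    subst hN hC
    linear_combination (-2 * (a ^ 2 + 2 * a) * p ^ 2 * u ^ 2 * (a + 2) ^ 2) * hR
  nlinarith [sq_nonneg (L + C * p * u)]

lemma regularized_aux (n : ℕ) (hn : 5 ≤ n)
    (φ : EuclideanSpace ℝ (Fin n) → ℝ) (hφ : ContDiff ℝ (⊤ : ℕ∞) φ)
    (hsupp : HasCompactSupport φ) (ε : ℝ) (hε : 0 < ε) :
    ((n : ℝ) ^ 2 * ((n : ℝ) - 4) ^ 2 / 16) * ∫ x, (φ x) ^ 2 * ((‖x‖ ^ 2 + ε)⁻¹) ^ 2 ≤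
      ∫ x, (euclideanLaplacian φ x) ^ 2 := by
  have hn' : (5 : ℝ) ≤ n := by exact_mod_cast hn
  set a : ℝ := ((n : ℝ) - 4) / 2 with ha
  set C : ℝ := a ^ 2 + 2 * a with hC
  have hCC : (n : ℝ) ^ 2 * ((n : ℝ) - 4) ^ 2 / 16 = C ^ 2 := by rw [hC, ha]; ring
  let e : Fin n → EuclideanSpace ℝ (Fin n) := fun i => EuclideanSpace.single i 1
  let d : Fin n → EuclideanSpace ℝ (Fin n) → ℝ := fun i x => fderiv ℝ φ x (e i)
  let u : EuclideanSpace ℝ (Fin n) → ℝ := fun x => (‖x‖ ^ 2 + ε)⁻¹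
  have hw : ∀ x : EuclideanSpace ℝ (Fin n), ‖x‖ ^ 2 + ε ≠ 0 := fun x => by positivity
  have hu : ContDiff ℝ (⊤ : ℕ∞) u := ((contDiff_norm_sq ℝ).add contDiff_const).inv hw
  have hd : ∀ i, ContDiff ℝ (⊤ : ℕ∞) (d i) := fun i =>
    (hφ.fderiv_right (m := (⊤ : ℕ∞)) (by simp)).clm_apply contDiff_const
  have hx : ∀ i, ContDiff ℝ (⊤ : ℕ∞) (fun x : EuclideanSpace ℝ (Fin n) => x i) := fun i =>
    (EuclideanSpace.proj (𝕜 := ℝ) i).contDiff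
  let F : Fin n → EuclideanSpace ℝ (Fin n) → ℝ := fun i x =>
    φ x * (d i x * u x + (a + 1) * (φ x * (x i * u x ^ 2)))
  have hF : ∀ i, ContDiff ℝ (⊤ : ℕ∞) (F i) := fun i =>
    hφ.mul (((hd i).mul hu).add (contDiff_const.mul (hφ.mul ((hx i).mul (hu.pow 2)))))
  have hFs : ∀ i, HasCompactSupport (F i) := fun i => hsupp.mul_right
  have hle : (1 : WithTop ℕ∞) ≤ ((⊤ : ℕ∞) : WithTop ℕ∞) := by exact_mod_cast le_top
  have hFi := fun i => integral_fderiv_eq_zero_aux (F i) ((hF i).of_le hle) (hFs i) (e i)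
  have hdiff : ∀ {f : EuclideanSpace ℝ (Fin n) → ℝ} (_ : ContDiff ℝ (⊤ : ℕ∞) f) x,
      HasFDerivAt f (fderiv ℝ f x) x := fun hf x =>
    ((hf.differentiable (by simp)) x).hasFDerivAt
  have hu' : ∀ x i, fderiv ℝ u x (e i) = -(2 * x i * u x ^ 2) := by
    intro x i
    have h1 : HasFDerivAt (fun x : EuclideanSpace ℝ (Fin n) => ‖x‖ ^ 2 + ε)
        (2 • (innerSL ℝ x)) x := (hasStrictFDerivAt_norm_sq x).hasFDerivAt.add_const ε
    have h2 := (hasDerivAt_inv (hw x)).comp_hasFDerivAt x h1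
    have h3 : fderiv ℝ u x = _ := h2.fderiv
    rw [h3]
    simp [e, u, EuclideanSpace.inner_single_right]
    ring
  have hx' : ∀ x i, fderiv ℝ (fun x : EuclideanSpace ℝ (Fin n) => x i) x (e i) = 1 := by
    intro x i
    have h3 : fderiv ℝ (fun x : EuclideanSpace ℝ (Fin n) => x i) x
      = EuclideanSpace.proj (𝕜 := ℝ) i := (EuclideanSpace.proj (𝕜 := ℝ) i).fderiv
    rw [h3]; simp [e]
  have hF' : ∀ x i, fderiv ℝ (F i) x (e i) =
      d i x ^ 2 * u x + φ x * fderiv ℝ (d i) x (e i) * u x - 2 * φ x * (x i * d i x) * u x ^ 2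
      + (a + 1) * (2 * φ x * (x i * d i x) * u x ^ 2 + φ x ^ 2 * u x ^ 2
        - 4 * φ x ^ 2 * (x i) ^ 2 * u x ^ 3) := by
    intro x i
    have h := (hdiff hφ x).mul (((hdiff (hd i) x).mul (hdiff hu x)).add
      (((hdiff hφ x).mul ((hdiff (hx i) x).mul ((hdiff hu x).mul (hdiff hu x)))).const_mul (a + 1)))
    have hFe : F i = φ * (d i * u + fun y => (a + 1) *
        (φ * ((fun x : EuclideanSpace ℝ (Fin n) => x i) * (u * u))) y) := by
      funext y; simp only [F, Pi.mul_apply, Pi.add_apply]; ring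
    rw [hFe, h.fderiv]
    simp only [add_apply, smul_apply, smul_eq_mul,
      Pi.mul_apply, Pi.add_apply, hu', hx']
    have : fderiv ℝ φ x (e i) = d i x := rfl
    rw [this]
    ring
  have hdd : ∀ i, ContDiff ℝ (⊤ : ℕ∞) (fun x => fderiv ℝ (d i) x (e i)) := fun i =>
    ((hd i).fderiv_right (m := (⊤ : ℕ∞)) (by simp)).clm_apply contDiff_const
  have hlap : ∀ x, euclideanLaplacian φ x = ∑ i, fderiv ℝ (d i) x (e i) := fun x => rfl
  have hLi : Integrable (fun x => (euclideanLaplacian φ x) ^ 2) := by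
    have hc : Continuous (euclideanLaplacian φ) := by
      have : euclideanLaplacian φ = fun x => ∑ i, fderiv ℝ (d i) x (e i) := rfl
      rw [this]
      exact continuous_finsetSum _ fun i _ => (hdd i).continuous
    refine (hc.pow 2).integrable_of_hasCompactSupport ?_
    refine hsupp.mono' ?_
    intro x hxs
    by_contra hcon
    apply hxs
    have hz : ∀ i, fderiv ℝ (d i) x (e i) = 0 := by
      intro i
      have h1 : x ∉ tsupport (fun y => fderiv ℝ (d i) y (e i)) := fun h =>
        hcon (tsupport_fderiv_apply_subset ℝ (e i)
          (f := φ) (tsupport_fderiv_apply_subset ℝ (e i) h))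
      exact image_eq_zero_of_notMem_tsupport (f := fun y => fderiv ℝ (d i) y (e i)) h1
    simp [hlap, hz]
  have hPi : Integrable (fun x => (φ x) ^ 2 * (u x) ^ 2) := by
    refine Continuous.integrable_of_hasCompactSupport
      ((hφ.continuous.pow 2).mul (hu.continuous.pow 2)) ?_
    have : HasCompactSupport (fun x => φ x * (φ x * u x ^ 2)) := hsupp.mul_right
    have he : (fun x => (φ x) ^ 2 * (u x) ^ 2) = fun x => φ x * (φ x * u x ^ 2) := by
      funext x; ring
    rw [he]; exact this
  have hpt : ∀ x, C ^ 2 * ((φ x) ^ 2 * (u x) ^ 2) ≤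
      (euclideanLaplacian φ x) ^ 2 + 2 * C * ∑ i, fderiv ℝ (F i) x (e i) := by
    intro x
    have hsum : ∑ i, fderiv ℝ (F i) x (e i) =
        (∑ i, d i x ^ 2) * u x + φ x * (euclideanLaplacian φ x) * u x
        - 2 * φ x * (∑ i, x i * d i x) * u x ^ 2
        + (a + 1) * (2 * φ x * (∑ i, x i * d i x) * u x ^ 2 + n * φ x ^ 2 * u x ^ 2
          - 4 * φ x ^ 2 * (∑ i, (x i) ^ 2) * u x ^ 3) := by
      simp only [hF', hlap, Finset.sum_add_distrib, Finset.sum_sub_distrib, ← Finset.mul_sum,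
        ← Finset.sum_mul, Finset.sum_const, Finset.card_univ, Fintype.card_fin, nsmul_eq_mul]
      ring
    rw [hsum]
    have hR : (∑ i, (x i) ^ 2) = ‖x‖ ^ 2 := (EuclideanSpace.real_norm_sq_eq x).symm
    refine pointwise_aux a C n _ (φ x) (u x) _ _ _ ε ?_ ?_ hC ?_ hε.le ?_ ?_
    · rw [ha]; linarith
    · rw [ha]; ring
    · simp only [u]; positivity
    · rw [hR]
      have := hw x
      simp only [u]
      field_simp
      ring
    · have : ∑ i, d i x ^ 2 + 2 * a * φ x * u x * ∑ i, x i * d i x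
          + a ^ 2 * φ x ^ 2 * u x ^ 2 * ∑ i, (x i) ^ 2
          = ∑ i, (d i x + a * φ x * u x * x i) ^ 2 := by
        rw [Finset.mul_sum, Finset.mul_sum, ← Finset.sum_add_distrib, ← Finset.sum_add_distrib]
        exact Finset.sum_congr rfl fun i _ => by ring
      rw [this]
      exact Finset.sum_nonneg fun i _ => sq_nonneg _
  have hSi : Integrable (fun x => ∑ i, fderiv ℝ (F i) x (e i)) :=
    integrable_finsetSum _ fun i _ => (hFi i).1
  have hS0 : ∫ x, ∑ i, fderiv ℝ (F i) x (e i) = 0 := by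
    rw [integral_finsetSum _ fun i _ => (hFi i).1]
    exact Finset.sum_eq_zero fun i _ => (hFi i).2
  have hfin := integral_mono (hPi.const_mul (C ^ 2)) (hLi.add (hSi.const_mul (2 * C))) hpt
  simp only [Pi.add_apply] at hfin
  rw [integral_add hLi (hSi.const_mul (2 * C)), integral_const_mul, integral_const_mul, hS0] at hfin
  rw [hCC]
  rw [mul_zero, add_zero] at hfin
  exact hfin

/-- Classical Rellich inequality on ℝⁿ, n ≥ 5. -/
theorem rellich_inequality_euclidean (n : ℕ) (hn : 5 ≤ n)
    (φ : EuclideanSpace ℝ (Fin n) → ℝ) (hφ : ContDiff ℝ (⊤ : ℕ∞) φ)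
    (hsupp : HasCompactSupport φ) :
    ((n : ℝ) ^ 2 * ((n : ℝ) - 4) ^ 2 / 16) * ∫ x, (φ x) ^ 2 / ‖x‖ ^ 4 ≤
      ∫ x, (euclideanLaplacian φ x) ^ 2 := by
  by_cases hI : Integrable (fun x => (φ x) ^ 2 / ‖x‖ ^ 4)
  swap
  · rw [integral_undef hI, mul_zero]
    exact integral_nonneg fun x => sq_nonneg _
  have : Nonempty (Fin n) := ⟨⟨0, by omega⟩⟩
  have hne : ∀ᵐ x : EuclideanSpace ℝ (Fin n), x ≠ 0 := by
    simp [ae_iff]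
  have hlim : Filter.Tendsto
      (fun k : ℕ => ∫ x, (φ x) ^ 2 * ((‖x‖ ^ 2 + 1 / ((k : ℝ) + 1))⁻¹) ^ 2) Filter.atTop
      (nhds (∫ x, (φ x) ^ 2 / ‖x‖ ^ 4)) := by
    refine tendsto_integral_of_dominated_convergence _ (fun k => ?_) hI (fun k => ?_) ?_
    · have : ∀ x : EuclideanSpace ℝ (Fin n), ‖x‖ ^ 2 + 1 / ((k : ℝ) + 1) ≠ 0 :=
        fun x => by positivity
      have hφc := hφ.continuous
      exact ((hφc.pow 2).mul ((Continuous.inv₀ (by fun_prop) this).pow 2)).aestronglyMeasurable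
    · filter_upwards [hne] with x hx
      have hx0 : 0 < ‖x‖ := norm_pos_iff.mpr hx
      have hk : (0 : ℝ) < 1 / ((k : ℝ) + 1) := by positivity
      rw [Real.norm_of_nonneg (by positivity), div_eq_mul_inv (φ x ^ 2)]
      have h1 : (‖x‖ ^ 2 + 1 / ((k : ℝ) + 1))⁻¹ ≤ (‖x‖ ^ 2)⁻¹ :=
        inv_anti₀ (by positivity) (by linarith)
      have h2 : (‖x‖ ^ 4)⁻¹ = ((‖x‖ ^ 2)⁻¹) ^ 2 := by rw [inv_pow, ← pow_mul]
      rw [h2]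
      gcongr
    · filter_upwards [hne] with x hx
      have hx0 : 0 < ‖x‖ := norm_pos_iff.mpr hx
      have h2 : (φ x) ^ 2 / ‖x‖ ^ 4 = (φ x) ^ 2 * ((‖x‖ ^ 2 + 0)⁻¹) ^ 2 := by
        rw [add_zero, inv_pow, ← pow_mul, div_eq_mul_inv]
      rw [h2]
      exact (((tendsto_one_div_add_atTop_nhds_zero_nat.const_add _).inv₀
        (by positivity)).pow 2).const_mul _
  exact le_of_tendsto (hlim.const_mul _) (Filter.Eventually.of_forall fun k =>
    regularized_aux n hn φ hφ hsupp _ (by positivity))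
end
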